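/- arXiv:1609.09662 — 2 statements merged into one kernel-verified Lean document; each statement's English description precedes it below -/
import Mathlib

section
/- The only filled dihedral groups are D₆, D₈, D₁₀, D₁₂, D₁₄ and D₂₂ (of orders 6, 8, 10, 12, 14, 22). -/
open Pointwise

/-- `S` is product-free if `S ∩ SS = ∅`. -/
def ProductFree {G : Type*} [Group G] (S : Set G) : Prop :=
  Disjoint S (S * S)

/-- `S` is locally maximal product-free if it is product-free and not properly
contained in any product-free set. -/
def LocallyMaximalPF {G : Type*} [Group G] (S : Set G) : Prop :=
  ProductFree S ∧ ∀ T : Set G, ProductFree T → S ⊆ T → S = T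

/-- `S` fills `G` (is complete) if every non-identity element lies in `S ∪ SS`. -/
def Fills {G : Type*} [Group G] (S : Set G) : Prop :=
  ∀ g : G, g ≠ 1 → g ∈ S ∪ S * S

/-- `G` is filled if every locally maximal product-free set fills `G`. -/
def Filled (G : Type*) [Group G] : Prop :=
  ∀ S : Set G, LocallyMaximalPF S → Fills S

namespace FilledDihedral

/-! ### Certificates for groups that are not filled -/

/-- A product-free set that is locally maximal but does not fill, in elementwise form. -/
def Cert (G : Type*) [Group G] : Prop :=
  ∃ (S : Set G) (g : G),
    (∀ x ∈ S, ∀ y ∈ S, x * y ∉ S) ∧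
    (∀ x, x ∈ S ∨ (∃ y ∈ S, ∃ z ∈ S, y * z = x) ∨ x * x ∈ S ∨
      ∃ s ∈ S, x * s ∈ S ∨ s * x ∈ S) ∧
    g ≠ 1 ∧ g ∉ S ∧ ∀ x ∈ S, ∀ y ∈ S, x * y ≠ g

lemma productFree_iff {G : Type*} [Group G] (S : Set G) :
    ProductFree S ↔ ∀ x ∈ S, ∀ y ∈ S, x * y ∉ S := by
  unfold ProductFree
  rw [Set.disjoint_left]
  constructor
  · intro h x hx y hy hxy
    exact h hxy (Set.mul_mem_mul hx hy)
  · rintro h z hz ⟨x, hx, y, hy, rfl⟩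
    exact h x hx y hy hz

lemma Cert.not_filled {G : Type*} [Group G] (h : Cert G) : ¬ Filled G := by
  obtain ⟨S, g, hpf, hcov, hg1, hgS, hgSS⟩ := h
  intro hF
  have hLM : LocallyMaximalPF S := by
    refine ⟨(productFree_iff S).2 hpf, fun T hT hST => ?_⟩
    rw [productFree_iff] at hT
    refine Set.Subset.antisymm hST fun t ht => ?_
    rcases hcov t with h | ⟨y, hy, z, hz, rfl⟩ | h | ⟨s, hs, h | h⟩
    · exact h
    · exact absurd ht (hT y (hST hy) z (hST hz))
    · exact absurd (hST h) (hT t ht t ht)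
    · exact absurd (hST h) (hT t ht s (hST hs))
    · exact absurd (hST h) (hT s (hST hs) t ht)
  rcases hF S hLM g hg1 with h | ⟨x, hx, y, hy, h⟩
  · exact hgS h
  · exact hgSS x hx y hy h

lemma Cert.pullback {G H : Type*} [Group G] [Group H] (f : G →* H)
    (hf : Function.Surjective f) (h : Cert H) : Cert G := by
  obtain ⟨S, g, hpf, hcov, hg1, hgS, hgSS⟩ := h
  obtain ⟨g', rfl⟩ := hf g
  refine ⟨f ⁻¹' S, g', ?_, ?_, ?_, hgS, ?_⟩
  · intro x hx y hy hxy
    exact hpf _ hx _ hy (by simpa using hxy)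
  · intro x
    rcases hcov (f x) with h | ⟨y, hy, z, hz, h⟩ | h | ⟨s, hs, h⟩
    · exact Or.inl h
    · obtain ⟨y', rfl⟩ := hf y
      refine Or.inr (Or.inl ⟨y', hy, y'⁻¹ * x, ?_, by group⟩)
      have : f (y'⁻¹ * x) = z := by rw [map_mul, map_inv, ← h]; group
      simpa [Set.mem_preimage, this] using hz
    · exact Or.inr (Or.inr (Or.inl (by simpa using h)))
    · obtain ⟨s', rfl⟩ := hf s
      exact Or.inr (Or.inr (Or.inr ⟨s', hs, by simpa using h⟩))
  · rintro rfl
    exact hg1 (map_one f)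
  · rintro x hx y hy rfl
    exact hgSS _ hx _ hy (map_mul f x y).symm

/-! ### Certificates in terms of rotations and reflections -/

lemma cert_dihedral {n : ℕ} (A B : ZMod n → Prop) (g : ZMod n)
    (c1 : ∀ x y, A x → A y → ¬ A (x + y))
    (c2 : ∀ x y, B x → B y → ¬ A (y - x))
    (c3 : ∀ x, B x ∨ ∃ y, A y ∧ (B (x + y) ∨ B (x - y)))
    (c4 : ∀ x, A x ∨ A (x + x) ∨
      ∃ y, (A y ∧ A (x - y)) ∨ (A y ∧ A (x + y)) ∨ (B y ∧ B (x + y)))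
    (g0 : g ≠ 0) (gA : ¬ A g) (gAA : ∀ y, A y → ¬ A (g - y))
    (gBB : ∀ y, B y → ¬ B (g + y)) : Cert (DihedralGroup n) := by
  refine ⟨{x | match x with | .r i => A i | .sr i => B i}, .r g, ?_, ?_, ?_, gA, ?_⟩
  · rintro (i | i) hi (j | j) hj h
    · exact c1 i j hi hj h
    · refine c2 (j - i) j h hj ?_
      simpa using hi
    · refine c2 i (i + j) hi h ?_
      simpa using hj
    · exact c2 i j hi hj h
  · rintro (i | i)
    · rcases c4 i with h | h | ⟨y, ⟨h1, h2⟩ | ⟨h1, h2⟩ | ⟨h1, h2⟩⟩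
      · exact Or.inl h
      · exact Or.inr (Or.inr (Or.inl h))
      · exact Or.inr (Or.inl ⟨.r y, h1, .r (i - y), h2, by simp⟩)
      · exact Or.inr (Or.inr (Or.inr ⟨.r y, h1, Or.inl h2⟩))
      · exact Or.inr (Or.inl ⟨.sr y, h1, .sr (i + y), h2, by simp⟩)
    · rcases c3 i with h | ⟨y, h1, h2 | h2⟩
      · exact Or.inl h
      · exact Or.inr (Or.inl ⟨.r y, h1, .sr (i + y), h2, by simp⟩)
      · exact Or.inr (Or.inl ⟨.sr (i - y), h2, .r y, h1, by simp⟩)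
  · intro h
    rw [DihedralGroup.one_def] at h
    exact g0 (DihedralGroup.r.inj h)
  · rintro (i | i) hi (j | j) hj h
    · have h := DihedralGroup.r.inj h
      refine gAA i hi ?_
      rw [← h]
      simpa using hj
    · cases h
    · cases h
    · have h := DihedralGroup.r.inj h
      refine gBB i hi ?_
      rw [← h]
      simpa using hj

lemma cert8 : Cert (DihedralGroup 8) := by
  refine cert_dihedral (n := 8) (· ∈ ({2, 3} : Finset (ZMod 8)))
    (· ∈ ({0, 4} : Finset (ZMod 8))) 1 ?_ ?_ ?_ ?_ ?_ ?_ ?_ ?_ <;> decide +kernel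

lemma cert9 : Cert (DihedralGroup 9) := by
  refine cert_dihedral (n := 9) (· ∈ ({2, 7} : Finset (ZMod 9)))
    (· ∈ ({0, 3, 6} : Finset (ZMod 9))) 1 ?_ ?_ ?_ ?_ ?_ ?_ ?_ ?_ <;> decide +kernel

lemma cert10 : Cert (DihedralGroup 10) := by
  refine cert_dihedral (n := 10) (· ∈ ({6, 7} : Finset (ZMod 10)))
    (· ∈ ({1, 6} : Finset (ZMod 10))) 1 ?_ ?_ ?_ ?_ ?_ ?_ ?_ ?_ <;> decide +kernel

lemma cert12 : Cert (DihedralGroup 12) := by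
  refine cert_dihedral (n := 12) (· ∈ ({7, 8, 9} : Finset (ZMod 12)))
    (· ∈ ({5, 11} : Finset (ZMod 12))) 1 ?_ ?_ ?_ ?_ ?_ ?_ ?_ ?_ <;> decide +kernel

lemma cert14 : Cert (DihedralGroup 14) := by
  refine cert_dihedral (n := 14) (· ∈ ({5, 8, 9, 12} : Finset (ZMod 14)))
    (· ∈ ({1, 5, 8, 12} : Finset (ZMod 14))) 1 ?_ ?_ ?_ ?_ ?_ ?_ ?_ ?_ <;> decide +kernel

lemma cert22 : Cert (DihedralGroup 22) := by
  refine cert_dihedral (n := 22) (· ∈ ({3, 4, 5, 14, 16} : Finset (ZMod 22)))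
    (· ∈ ({5, 7, 14, 16} : Finset (ZMod 22))) 1 ?_ ?_ ?_ ?_ ?_ ?_ ?_ ?_ <;> decide +kernel

lemma val_add_cases {n : ℕ} [NeZero n] (x y : ZMod n) :
    (x + y).val = x.val + y.val ∨ (x + y).val + n = x.val + y.val := by
  rcases lt_or_ge (x.val + y.val) n with h | h
  · exact Or.inl (ZMod.val_add_of_lt h)
  · right
    have := ZMod.val_add_of_le h
    omega

lemma val_sub_cases {n : ℕ} [NeZero n] (x y : ZMod n) :
    x.val = (x - y).val + y.val ∨ x.val + n = (x - y).val + y.val := by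
  simpa using val_add_cases (x - y) y

/-- The infinite family: odd `n = 2h+1 ≥ 13`. -/
lemma cert_odd (h : ℕ) (hh : 6 ≤ h) : Cert (DihedralGroup (2 * h + 1)) := by
  have key : ∀ k : ℕ, k < 2 * h + 1 → ((k : ZMod (2 * h + 1))).val = k :=
    fun k hk => ZMod.val_natCast_of_lt hk
  refine cert_dihedral (n := 2 * h + 1)
    (fun x => x.val % 2 = 1 ∧ 3 ≤ x.val ∧ x.val ≤ h + 1) (fun x => x.val ≤ 2)
    ((4 : ℕ) : ZMod (2 * h + 1)) ?_ ?_ ?_ ?_ ?_ ?_ ?_ ?_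
  · intro x y hx hy
    have := val_add_cases x y
    have := ZMod.val_lt (x + y)
    omega
  · intro x y hx hy
    have := val_sub_cases y x
    have := ZMod.val_lt (y - x)
    omega
  · intro x
    have hx := ZMod.val_lt x
    -- a suitable translate by the rotation `k`
    suffices H : x.val ≤ 2 ∨ ∃ k, k < 2 * h + 1 ∧ (k % 2 = 1 ∧ 3 ≤ k ∧ k ≤ h + 1) ∧
        ((k ≤ x.val ∧ x.val ≤ k + 2) ∨
          (2 * h + 1 ≤ x.val + k ∧ x.val + k ≤ 2 * h + 3)) by
      rcases H with H | ⟨k, hk, h1, h2⟩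
      · exact Or.inl H
      · refine Or.inr ⟨(k : ZMod (2 * h + 1)), by rw [key k hk]; exact h1, ?_⟩
        have e := key k hk
        have a1 := val_add_cases x (k : ZMod (2 * h + 1))
        have a2 := val_sub_cases x (k : ZMod (2 * h + 1))
        have a3 := ZMod.val_lt (x + (k : ZMod (2 * h + 1)))
        have a4 := ZMod.val_lt (x - (k : ZMod (2 * h + 1)))
        omega
    generalize x.val = v at *
    by_cases c0 : v ≤ 2
    · exact Or.inl c0
    right
    by_cases c1 : v ≤ h + 2
    · rcases Nat.mod_two_eq_zero_or_one v with p | p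
      · exact ⟨v - 1, by omega⟩
      · by_cases c2 : v ≤ h + 1
        · exact ⟨v, by omega⟩
        · exact ⟨v - 2, by omega⟩
    · rcases Nat.mod_two_eq_zero_or_one v with p | p
      · by_cases c2 : v + 1 = 2 * h + 1
        · exact ⟨3, by omega⟩
        · exact ⟨2 * h + 1 - v, by omega⟩
      · exact ⟨2 * h + 2 - v, by omega⟩
  · intro x
    have hx := ZMod.val_lt x
    suffices H : (x.val % 2 = 1 ∧ 3 ≤ x.val ∧ x.val ≤ h + 1) ∨ x.val = h + 2 ∧ h % 2 = 1 ∨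
        ∃ k, k < 2 * h + 1 ∧
          (((k % 2 = 1 ∧ 3 ≤ k ∧ k ≤ h + 1) ∧ k ≤ x.val ∧
            (x.val - k) % 2 = 1 ∧ 3 ≤ x.val - k ∧ x.val - k ≤ h + 1) ∨
          ((k % 2 = 1 ∧ 3 ≤ k ∧ k ≤ h + 1) ∧
            ((x.val + k < 2 * h + 1 ∧ (x.val + k) % 2 = 1 ∧ x.val + k ≤ h + 1) ∨
            (2 * h + 1 ≤ x.val + k ∧ (x.val + k) % 2 = 0 ∧ 2 * h + 4 ≤ x.val + k ∧
              x.val + k ≤ 3 * h + 2))) ∨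
          (k ≤ 2 ∧ (x.val + k ≤ 2 ∨ 2 * h + 1 ≤ x.val + k))) by
      rcases H with H | H | ⟨k, hk, H⟩
      · exact Or.inl H
      · refine Or.inr (Or.inl ?_)
        have a1 := val_add_cases x x
        have a3 := ZMod.val_lt (x + x)
        omega
      · refine Or.inr (Or.inr ⟨(k : ZMod (2 * h + 1)), ?_⟩)
        have e := key k hk
        have a1 := val_add_cases x (k : ZMod (2 * h + 1))
        have a2 := val_sub_cases x (k : ZMod (2 * h + 1))
        have a3 := ZMod.val_lt (x + (k : ZMod (2 * h + 1)))
        have a4 := ZMod.val_lt (x - (k : ZMod (2 * h + 1)))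
        rcases H with H | H | H
        · left; omega
        · right; left; omega
        · right; right; omega
    generalize x.val = v at *
    by_cases c0 : v ≤ 2
    · exact Or.inr (Or.inr ⟨0, by omega⟩)
    by_cases c0' : 2 * h - 1 ≤ v
    · exact Or.inr (Or.inr ⟨2, by omega⟩)
    rcases Nat.mod_two_eq_zero_or_one v with p | p
    · right; right
      by_cases c1 : v = 4
      · exact ⟨3, by omega⟩
      by_cases c2 : v ≤ h + 4
      · exact ⟨3, by omega⟩
      rcases Nat.mod_two_eq_zero_or_one h with q | q
      · exact ⟨h + 1, by omega⟩
      · exact ⟨h, by omega⟩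
    · by_cases c1 : v ≤ h + 1
      · left; omega
      by_cases c2 : v = h + 2
      · right; left; omega
      right; right
      exact ⟨2 * h + 4 - v, by omega⟩
  · intro e
    have := congrArg ZMod.val e
    rw [key 4 (by omega), ZMod.val_zero] at this
    omega
  · rw [key 4 (by omega)]
    omega
  · intro y hy
    have a2 := val_sub_cases ((4 : ℕ) : ZMod (2 * h + 1)) y
    have a4 := ZMod.val_lt (((4 : ℕ) : ZMod (2 * h + 1)) - y)
    rw [key 4 (by omega)] at a2
    omega
  · intro y hy
    have a2 := val_add_cases ((4 : ℕ) : ZMod (2 * h + 1)) y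
    rw [key 4 (by omega)] at a2
    omega

/-- The reduction `D_{4m} → D_{2m}`. -/
lemma cert_double (m : ℕ) (h : Cert (DihedralGroup m)) : Cert (DihedralGroup (2 * m)) := by
  let c : ZMod (2 * m) →+* ZMod m := ZMod.castHom (Dvd.intro_left 2 rfl) (ZMod m)
  have hc : Function.Surjective c := ZMod.castHom_surjective _
  let f : DihedralGroup (2 * m) →* DihedralGroup m :=
    { toFun := fun x => match x with
        | .r i => .r (c i)
        | .sr i => .sr (c i)
      map_one' := by
        rw [DihedralGroup.one_def, DihedralGroup.one_def]
        simp
      map_mul' := by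
        rintro (i | i) (j | j) <;> simp }
  refine Cert.pullback f ?_ h
  rintro (i | i)
  · obtain ⟨j, rfl⟩ := hc i
    exact ⟨.r j, rfl⟩
  · obtain ⟨j, rfl⟩ := hc i
    exact ⟨.sr j, rfl⟩

lemma cert_all (n : ℕ) (hn : 8 ≤ n) (h11 : n ≠ 11) : Cert (DihedralGroup n) := by
  induction n using Nat.strong_induction_on with
  | _ n ih =>
    rcases Nat.even_or_odd' n with ⟨m, rfl | rfl⟩
    · by_cases hm : 8 ≤ m ∧ m ≠ 11
      · exact cert_double m (ih m (by omega) hm.1 hm.2)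
      · have : m = 4 ∨ m = 5 ∨ m = 6 ∨ m = 7 ∨ m = 11 := by omega
        rcases this with rfl | rfl | rfl | rfl | rfl
        · exact cert8
        · exact cert10
        · exact cert12
        · exact cert14
        · exact cert22
    · by_cases hm : 6 ≤ m
      · exact cert_odd m hm
      · have : m = 4 := by omega
        subst this
        exact cert9

/-! ### The filled groups -/

/-- If every pair (rotations, reflections) has the right property then the group is filled. -/
lemma filled_of {n : ℕ}
    (H : ∀ A B : ZMod n → Prop,
      (∀ x y, A x → A y → ¬ A (x + y)) →
      (∀ x y, B x → B y → ¬ A (y - x)) →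
      (∀ x, B x ∨ ∃ y, A y ∧ (B (x + y) ∨ B (x - y))) →
      (∀ x, x = 0 ∨ A x ∨ A (x + x) ∨
        ∃ y, (A y ∧ A (x - y)) ∨ (A y ∧ A (x + y)) ∨ (B y ∧ B (x + y))) →
      ∀ x, x = 0 ∨ A x ∨ ∃ y, (A y ∧ A (x - y)) ∨ (B y ∧ B (x + y))) :
    Filled (DihedralGroup n) := by
  rintro S ⟨hpf, hmax⟩
  rw [productFree_iff] at hpf
  have h1 : (1 : DihedralGroup n) ∉ S := fun h => hpf 1 h 1 h (by simpa using h)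
  have hcov : ∀ g, g ∉ S → g = 1 ∨ (∃ y ∈ S, ∃ z ∈ S, y * z = g) ∨ g * g ∈ S ∨
      ∃ s ∈ S, g * s ∈ S ∨ s * g ∈ S := by
    intro g hg
    by_contra hcon
    push Not at hcon
    obtain ⟨k1, k2, k3, k4⟩ := hcon
    have hT : ProductFree (insert g S) := by
      rw [productFree_iff]
      rintro x (rfl | hx) y (rfl | hy) (h | h)
      · exact k1 (by simpa using h)
      · exact k3 h
      · exact h1 (by have : y = 1 := by simpa using h
                     rwa [← this])
      · exact (k4 y hy).1 h
      · exact h1 (by have : x = 1 := by simpa using h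
                     rwa [← this])
      · exact (k4 x hx).2 h
      · exact k2 x hx y hy h
      · exact hpf x hx y hy h
    have := hmax _ hT (Set.subset_insert g S)
    exact hg (this ▸ Set.mem_insert g S)
  have hB : ∀ x, .sr x ∈ S ∨ ∃ y, .r y ∈ S ∧
      (DihedralGroup.sr (x + y) ∈ S ∨ DihedralGroup.sr (x - y) ∈ S) := by
    intro i
    by_cases hi : DihedralGroup.sr i ∈ S
    · exact Or.inl hi
    right
    rcases hcov _ hi with h | ⟨j | j, hj, k | k, hk, h⟩ | h | ⟨j | j, hj, h | h⟩
    · rw [DihedralGroup.one_def] at h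
      cases h
    · cases h
    · have h := DihedralGroup.sr.inj h
      refine ⟨j, hj, Or.inl ?_⟩
      rw [← h]
      simpa using hk
    · have h := DihedralGroup.sr.inj h
      refine ⟨k, hk, Or.inr ?_⟩
      rw [← h]
      simpa using hj
    · cases h
    · exact absurd (by simpa using h) h1
    · exact ⟨j, hj, Or.inl h⟩
    · exact ⟨j, hj, Or.inr h⟩
    · refine ⟨j - i, h, Or.inl ?_⟩
      simpa using hj
    · refine ⟨i - j, h, Or.inr ?_⟩
      simpa using hj
  have hA : ∀ x, x = 0 ∨ .r x ∈ S ∨ DihedralGroup.r (x + x) ∈ S ∨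
      ∃ y, (.r y ∈ S ∧ DihedralGroup.r (x - y) ∈ S) ∨
        (.r y ∈ S ∧ DihedralGroup.r (x + y) ∈ S) ∨
        (.sr y ∈ S ∧ DihedralGroup.sr (x + y) ∈ S) := by
    intro i
    by_cases hi : DihedralGroup.r i ∈ S
    · exact Or.inr (Or.inl hi)
    rcases hcov _ hi with h | ⟨j | j, hj, k | k, hk, h⟩ | h | ⟨j | j, hj, h | h⟩
    · rw [DihedralGroup.one_def] at h
      exact Or.inl (DihedralGroup.r.inj h)
    · have h := DihedralGroup.r.inj h
      refine Or.inr (Or.inr (Or.inr ⟨j, Or.inl ⟨hj, ?_⟩⟩))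
      rw [← h]
      simpa using hk
    · cases h
    · cases h
    · have h := DihedralGroup.r.inj h
      refine Or.inr (Or.inr (Or.inr ⟨j, Or.inr (Or.inr ⟨hj, ?_⟩)⟩))
      rw [← h]
      simpa using hk
    · exact Or.inr (Or.inr (Or.inl h))
    · exact Or.inr (Or.inr (Or.inr ⟨j, Or.inr (Or.inl ⟨hj, h⟩)⟩))
    · refine Or.inr (Or.inr (Or.inr ⟨j, Or.inr (Or.inl ⟨hj, ?_⟩)⟩))
      rw [add_comm]
      exact h
    · refine Or.inr (Or.inr (Or.inr ⟨j - i, Or.inr (Or.inr ⟨h, ?_⟩)⟩))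
      simpa using hj
    · refine Or.inr (Or.inr (Or.inr ⟨j, Or.inr (Or.inr ⟨hj, ?_⟩)⟩))
      rw [add_comm]
      exact h
  have hfin := H (fun x => .r x ∈ S) (fun x => .sr x ∈ S)
    (fun x y hx hy h => hpf _ hx _ hy h) (fun x y hx hy h => hpf _ hx _ hy h) hB hA
  rintro (i | i) hg
  · rcases hfin i with h | h | ⟨y, ⟨h1, h2⟩ | ⟨h1, h2⟩⟩
    · subst h
      exact absurd rfl hg
    · exact Or.inl h
    · exact Or.inr ⟨_, h1, _, h2, by simp⟩
    · exact Or.inr ⟨_, h1, _, h2, by simp⟩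
  · rcases hB i with h | ⟨y, h1, h2 | h2⟩
    · exact Or.inl h
    · exact Or.inr ⟨_, h1, _, h2, by simp⟩
    · exact Or.inr ⟨_, h2, _, h1, by simp⟩

/-- Bounded universal quantifier, by plain recursion. -/
def allB (n : ℕ) (p : ℕ → Bool) : Bool :=
  Nat.rec true (fun k ih => p k && ih) n

/-- Bounded existential quantifier. -/
def exB (n : ℕ) (p : ℕ → Bool) : Bool :=
  Nat.rec false (fun k ih => p k || ih) n

lemma allB_iff (n : ℕ) (p : ℕ → Bool) : allB n p = true ↔ ∀ i < n, p i = true := by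
  induction n with
  | zero => simp [allB]
  | succ k ih =>
    have : allB (k + 1) p = (p k && allB k p) := rfl
    rw [this, Bool.and_eq_true, ih, Nat.forall_lt_succ_right, and_comm]

lemma exB_iff (n : ℕ) (p : ℕ → Bool) : exB n p = true ↔ ∃ i < n, p i = true := by
  induction n with
  | zero => simp [exB]
  | succ k ih =>
    have : exB (k + 1) p = (p k || exB k p) := rfl
    rw [this, Bool.or_eq_true, ih, Nat.exists_lt_succ_right, or_comm]

def sumFreeB (n a : ℕ) : Bool :=
  allB n fun i => !a.testBit i || allB n fun j => !a.testBit j || !a.testBit ((i + j) % n)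

/-- The mask of all `j` such that `j + 1` or its negative belongs to `a`. -/
def diffMask (n a : ℕ) : ℕ :=
  Nat.rec 0 (fun k ih => Nat.lor ih
    (cond (a.testBit (k + 1) || a.testBit (n - 1 - k)) (2 ^ k) 0)) (n - 1)

/-- Check `leaf` for all masks in which no two elements have a difference marked in `m`;
the bits are chosen from the highest one downwards. -/
def treeAll (m : ℕ) (leaf : ℕ → Bool) (n : ℕ) : ℕ → Bool :=
  Nat.rec leaf (fun _ ih acc => ih (2 * acc) &&
    (!(Nat.land acc m).beq 0 || ih (2 * acc + 1))) n

lemma diffMask_spec (n a j : ℕ) (h : (diffMask n a).testBit j = true) :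
    a.testBit (j + 1) = true ∨ a.testBit (n - 1 - j) = true := by
  unfold diffMask at h
  generalize n - 1 = m at h ⊢
  suffices H : ∀ l : ℕ, (Nat.rec 0 (fun k ih => Nat.lor ih
      (cond (a.testBit (k + 1) || a.testBit (m - k)) (2 ^ k) 0)) l : ℕ).testBit j = true →
      a.testBit (j + 1) = true ∨ a.testBit (m - j) = true from H m h
  intro l
  induction l with
  | zero => simp
  | succ k ih =>
    intro h
    have h' := (Nat.testBit_or _ _ j).symm.trans h
    rw [Bool.or_eq_true] at h'
    rcases h' with h' | h'
    · exact ih h'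
    · by_cases c : (a.testBit (k + 1) || a.testBit (m - k)) = true
      · rw [c, cond_true, Nat.testBit_two_pow, decide_eq_true_eq] at h'
        subst h'
        simpa using c
      · rw [Bool.not_eq_true] at c
        rw [c, cond_false] at h'
        simp at h'

lemma treeAll_spec (m : ℕ) (leaf : ℕ → Bool) (t : ℕ) (k : ℕ)
    (ht : ∀ i < k, t.testBit i = true → (t >>> (i + 1)) &&& m = 0)
    (h : treeAll m leaf k (t >>> k) = true) : leaf t = true := by
  induction k with
  | zero => exact h
  | succ k ih =>
    have h' : (treeAll m leaf k (2 * (t >>> (k + 1))) &&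
        (!(Nat.land (t >>> (k + 1)) m).beq 0 ||
          treeAll m leaf k (2 * (t >>> (k + 1)) + 1))) = true := h
    rw [Bool.and_eq_true] at h'
    refine ih (fun i hi => ht i (by omega)) ?_
    have e : t >>> (k + 1) = t >>> k / 2 := Nat.shiftRight_succ t k
    have tb : t.testBit k = decide (t >>> k % 2 = 1) := by
      rw [Nat.testBit_eq_decide_div_mod_eq, Nat.shiftRight_eq_div_pow]
    by_cases c : t.testBit k = true
    · have h0 : Nat.land (t >>> (k + 1)) m = 0 := ht k (by omega) c
      have h2 := h'.2
      rw [h0] at h2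
      rw [tb, decide_eq_true_eq] at c
      have e2 : 2 * (t >>> (k + 1)) + 1 = t >>> k := by omega
      rw [e2] at h2
      simpa using h2
    · rw [tb, decide_eq_true_eq] at c
      have e2 : 2 * (t >>> (k + 1)) = t >>> k := by omega
      rw [← e2]
      exact h'.1

def coverRefB (n a b : ℕ) : Bool :=
  allB n fun i => b.testBit i || exB n fun j => a.testBit j &&
    (b.testBit ((i + j) % n) || b.testBit ((i + (n - j)) % n))

def coverRotB (n a b : ℕ) : Bool :=
  allB n fun i => i.beq 0 || (a.testBit i || (a.testBit ((i + i) % n) || exB n fun j =>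
    (a.testBit j && a.testBit ((i + (n - j)) % n)) ||
    ((a.testBit j && a.testBit ((i + j) % n)) || (b.testBit j && b.testBit ((i + j) % n)))))

def fillB (n a b : ℕ) : Bool :=
  allB n fun i => i.beq 0 || (a.testBit i || exB n fun j =>
    (a.testBit j && a.testBit ((i + (n - j)) % n)) || (b.testBit j && b.testBit ((i + j) % n)))

def checkB (n : ℕ) : Bool :=
  allB (2 ^ n) fun a => !sumFreeB n a || treeAll (diffMask n a) (fun b =>
    !coverRefB n a b || (!coverRotB n a b || fillB n a b)) n 0

lemma filled_of_check (n : ℕ) [NeZero n] (hc : checkB n = true) :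
    Filled (DihedralGroup n) := by
  classical
  refine filled_of fun A B c1 c2 c3 c4 => ?_
  have mk : ∀ P : ZMod n → Prop, ∃ a < 2 ^ n, ∀ k < n, (a.testBit k = true ↔ P (k : ZMod n)) := by
    intro P
    refine ⟨Nat.ofBits fun i : Fin n => decide (P ((i : ℕ) : ZMod n)), Nat.ofBits_lt_two_pow _, ?_⟩
    intro k hk
    rw [Nat.testBit_ofBits_lt _ _ hk]
    simp
  obtain ⟨a, ha, hA⟩ := mk A
  obtain ⟨b, hb, hB⟩ := mk B
  have hn : 0 < n := Nat.pos_of_ne_zero (NeZero.ne n)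
  have add' : ∀ i j : ℕ, (((i + j) % n : ℕ) : ZMod n) = i + j := by
    intro i j
    rw [ZMod.natCast_mod, Nat.cast_add]
  have sub' : ∀ i j : ℕ, j < n → (((i + (n - j)) % n : ℕ) : ZMod n) = i - j := by
    intro i j hj
    rw [ZMod.natCast_mod, Nat.cast_add, Nat.cast_sub hj.le, ZMod.natCast_self]
    ring
  have Aadd : ∀ i j : ℕ, (a.testBit ((i + j) % n) = true ↔ A (i + j)) := fun i j => by
    rw [hA _ (Nat.mod_lt _ hn), add']
  have Badd : ∀ i j : ℕ, (b.testBit ((i + j) % n) = true ↔ B (i + j)) := fun i j => by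
    rw [hB _ (Nat.mod_lt _ hn), add']
  have Asub : ∀ i j : ℕ, j < n → (a.testBit ((i + (n - j)) % n) = true ↔ A (i - j)) :=
    fun i j hj => by rw [hA _ (Nat.mod_lt _ hn), sub' i j hj]
  have Bsub : ∀ i j : ℕ, j < n → (b.testBit ((i + (n - j)) % n) = true ↔ B (i - j)) :=
    fun i j hj => by rw [hB _ (Nat.mod_lt _ hn), sub' i j hj]
  have rep : ∀ x : ZMod n, ∃ k < n, (k : ZMod n) = x := fun x =>
    ⟨x.val, ZMod.val_lt x, ZMod.natCast_zmod_val x⟩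
  have imp : ∀ p q : Bool, (!p || q) = true → p = true → q = true := by decide
  have h1 := imp _ _ ((allB_iff _ _).1 hc a ha) <| by
    refine (allB_iff _ _).2 fun i hi => ?_
    by_cases e : a.testBit i = true
    · simp only [e, Bool.not_true, Bool.false_or]
      refine (allB_iff _ _).2 fun j hj => ?_
      by_cases e' : a.testBit j = true
      · have := c1 i j ((hA i hi).1 e) ((hA j hj).1 e')
        rw [← Aadd] at this
        simp [this]
      · simp [e']
    · simp [e]
  have h2 := treeAll_spec (diffMask n a) (fun b =>
      !coverRefB n a b || (!coverRotB n a b || fillB n a b)) b n (by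
    intro i hi hbi
    refine Nat.eq_of_testBit_eq fun j => ?_
    rw [Nat.zero_testBit, Nat.testBit_and, Nat.testBit_shiftRight, ← Bool.not_eq_true,
      Bool.and_eq_true]
    rintro ⟨u, v⟩
    have hj : i + 1 + j < n := by
      by_contra hcon
      rw [Nat.testBit_lt_two_pow
        (lt_of_lt_of_le hb (Nat.pow_le_pow_right (by norm_num) (by omega)))] at u
      cases u
    have hBi := (hB i hi).1 hbi
    have hBj := (hB _ hj).1 u
    rcases diffMask_spec n a j v with w | w
    · refine c2 _ _ hBi hBj ?_
      have := (hA _ (by omega)).1 w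
      convert this using 1
      push_cast
      ring
    · refine c2 _ _ hBj hBi ?_
      have := (hA _ (by omega)).1 w
      convert this using 1
      have e : n - 1 - j = n - (j + 1) := by omega
      rw [e, Nat.cast_sub (by omega), ZMod.natCast_self]
      push_cast
      ring) (by rw [Nat.shiftRight_eq_div_pow, Nat.div_eq_of_lt hb]; exact h1)
  have h3 := imp _ _ h2 <| by
    refine (allB_iff _ _).2 fun i hi => ?_
    rw [Bool.or_eq_true, exB_iff, hB i hi]
    rcases c3 i with h | ⟨y, h⟩
    · exact Or.inl h
    · obtain ⟨j, hj, rfl⟩ := rep y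
      refine Or.inr ⟨j, hj, ?_⟩
      rw [Bool.and_eq_true, Bool.or_eq_true, hA j hj, Bsub _ _ hj, Badd]
      exact h
  have h4 := imp _ _ h3 <| by
    refine (allB_iff _ _).2 fun i hi => ?_
    rw [Bool.or_eq_true, Bool.or_eq_true, Bool.or_eq_true, exB_iff, hA i hi, Aadd, Nat.beq_eq]
    rcases c4 i with h | h | h | ⟨y, h⟩
    · left
      rw [ZMod.natCast_eq_zero_iff] at h
      exact Nat.eq_zero_of_dvd_of_lt h hi
    · exact Or.inr (Or.inl h)
    · exact Or.inr (Or.inr (Or.inl h))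
    · obtain ⟨j, hj, rfl⟩ := rep y
      refine Or.inr (Or.inr (Or.inr ⟨j, hj, ?_⟩))
      rw [Bool.or_eq_true, Bool.or_eq_true, Bool.and_eq_true, Bool.and_eq_true,
        Bool.and_eq_true, hA j hj, hB j hj, Asub _ _ hj, Aadd, Badd]
      exact h
  intro x
  obtain ⟨i, hi, rfl⟩ := rep x
  have h5 := (allB_iff _ _).1 h4 i hi
  rw [Bool.or_eq_true, Bool.or_eq_true, exB_iff, hA i hi, Nat.beq_eq] at h5
  rcases h5 with h | h | ⟨j, hj, h⟩
  · left
    simp [h]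
  · exact Or.inr (Or.inl h)
  · refine Or.inr (Or.inr ⟨j, ?_⟩)
    rw [Bool.or_eq_true, Bool.and_eq_true,
        Bool.and_eq_true, hA j hj, hB j hj, Asub _ _ hj, Badd] at h
    exact h

lemma filled3 : Filled (DihedralGroup 3) := filled_of_check 3 (by decide +kernel)
lemma filled4 : Filled (DihedralGroup 4) := filled_of_check 4 (by decide +kernel)
lemma filled5 : Filled (DihedralGroup 5) := filled_of_check 5 (by decide +kernel)
lemma filled6 : Filled (DihedralGroup 6) := filled_of_check 6 (by decide +kernel)
lemma filled7 : Filled (DihedralGroup 7) := filled_of_check 7 (by decide +kernel)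
lemma filled11 : Filled (DihedralGroup 11) := filled_of_check 11 (by decide +kernel)

end FilledDihedral

theorem filled_dihedral_iff (n : ℕ) (hn : 3 ≤ n) :
    Filled (DihedralGroup n) ↔
      n = 3 ∨ n = 4 ∨ n = 5 ∨ n = 6 ∨ n = 7 ∨ n = 11 := by
  constructor
  · intro h
    by_contra hcon
    exact (FilledDihedral.cert_all n (by omega) (by omega)).not_filled h
  · rintro (rfl | rfl | rfl | rfl | rfl | rfl)
    · exact FilledDihedral.filled3
    · exact FilledDihedral.filled4
    · exact FilledDihedral.filled5
    · exact FilledDihedral.filled6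
    · exact FilledDihedral.filled7
    · exact FilledDihedral.filled11
end

section
/- The only filled finite 2-group of maximal class is the dihedral group D₈ of order 8. -/
open Pointwise

theorem productFree_iff {G : Type*} [Group G] (S : Set G) :
    ProductFree S ↔ ∀ a ∈ S, ∀ b ∈ S, a * b ∉ S := by
  unfold ProductFree
  rw [Set.disjoint_right]
  constructor
  · intro h a ha b hb
    exact h (Set.mul_mem_mul ha hb)
  · rintro h _ ⟨a, ha, b, hb, rfl⟩
    exact h a ha b hb

theorem locallyMaximalPF_iff {G : Type*} [Group G] (S : Set G) :
    LocallyMaximalPF S ↔ ProductFree S ∧ ∀ x, x ∉ S → ¬ ProductFree (insert x S) := by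
  constructor
  · rintro ⟨h1, h2⟩
    refine ⟨h1, fun x hx hp => hx ?_⟩
    rw [h2 _ hp (Set.subset_insert x S)]
    exact Set.mem_insert x S
  · rintro ⟨h1, h2⟩
    refine ⟨h1, fun T hT hST => Set.Subset.antisymm hST ?_⟩
    intro x hxT
    by_contra hx
    apply h2 x hx
    rw [productFree_iff] at hT ⊢
    have hsub : insert x S ⊆ T := Set.insert_subset hxT hST
    intro a ha b hb hab
    exact hT a (hsub ha) b (hsub hb) (hsub hab)

theorem filled_of_surjective {G H : Type*} [Group G] [Group H] (f : G →* H)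
    (hf : Function.Surjective f) (hG : Filled G) : Filled H := by
  intro S hS h hh
  have hS' := hS
  rw [locallyMaximalPF_iff, productFree_iff] at hS'
  obtain ⟨hpf, hmax⟩ := hS'
  by_cases hne : S.Nonempty
  swap
  · exfalso
    rw [Set.not_nonempty_iff_eq_empty] at hne
    subst hne
    apply hmax h (by simp)
    rw [productFree_iff]
    simpa using hh
  obtain ⟨s, hs⟩ := hne
  have hL : LocallyMaximalPF (f ⁻¹' S) := by
    rw [locallyMaximalPF_iff]
    constructor
    · rw [productFree_iff]
      intro a ha b hb hab
      exact hpf _ ha _ hb (by simpa using hab)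
    · intro x hx hp
      rw [productFree_iff] at hp
      have hx' : f x ∉ S := hx
      apply hmax (f x) hx'
      rw [productFree_iff]
      have key : ∀ g, f g ∈ S → g ∈ insert x (f ⁻¹' S) := fun g hg => Or.inr hg
      have kx : x ∈ insert x (f ⁻¹' S) := Or.inl rfl
      rintro a (rfl | ha) b (rfl | hb) (hab | hab)
      · have h1 : f x = 1 := by simpa using hab
        obtain ⟨g, rfl⟩ := hf s
        exact hp x kx g (key g hs) (key _ (by simpa [h1] using hs))
      · exact hp x kx x kx (key _ (by simpa using hab))
      · have h1 : b = 1 := by simpa using hab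
        subst h1
        exact hpf _ hb _ hb (by simpa using hb)
      · obtain ⟨g, rfl⟩ := hf b
        exact hp x kx g (key g hb) (key _ (by simpa using hab))
      · have h1 : a = 1 := by simpa using hab
        subst h1
        exact hpf _ ha _ ha (by simpa using ha)
      · obtain ⟨g, rfl⟩ := hf a
        exact hp g (key g ha) x kx (key _ (by simpa using hab))
      · obtain ⟨g, rfl⟩ := hf b
        refine hp (x * g⁻¹) (key _ ?_) g (key g hb) ?_
        · rw [map_mul, ← hab]
          simpa using ha
        · simp
      · exact hpf a ha b hb hab
  obtain ⟨g, rfl⟩ := hf h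
  rcases hG _ hL g (by rintro rfl; simp at hh) with h1 | ⟨a, ha, b, hb, rfl⟩
  · exact Or.inl h1
  · exact Or.inr ⟨f a, ha, f b, hb, by simp⟩

def tpf {α : Type*} (op : α → α → α) (p : α → Bool) : Prop :=
  ∀ a, p a = true → ∀ b, p b = true → p (op a b) = false

def tlm {α : Type*} [DecidableEq α] (op : α → α → α) (p : α → Bool) : Prop :=
  ∀ x, p x = false → ¬ tpf op (fun y => p y || decide (y = x))

instance {α : Type*} [Fintype α] (op : α → α → α) (p : α → Bool) : Decidable (tpf op p) := by
  unfold tpf; infer_instance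

instance {α : Type*} [Fintype α] [DecidableEq α] (op : α → α → α) (p : α → Bool) :
    Decidable (tlm op p) := by
  unfold tlm; infer_instance

theorem tpf_iff {α G : Type*} [Group G] (op : α → α → α) (f : α → G)
    (hf : Function.Bijective f) (hop : ∀ a b, f (op a b) = f a * f b) (p : α → Bool) (S : Set G)
    (hS : ∀ a, f a ∈ S ↔ p a = true) : ProductFree S ↔ tpf op p := by
  rw [productFree_iff]
  unfold tpf
  rw [hf.surjective.forall]
  refine forall_congr' fun a => ?_
  rw [hS, hf.surjective.forall]
  refine imp_congr_right fun _ => forall_congr' fun b => ?_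
  rw [hS, ← hop, hS]
  simp

theorem tlm_iff {α G : Type*} [Group G] [DecidableEq α] (op : α → α → α) (f : α → G)
    (hf : Function.Bijective f) (hop : ∀ a b, f (op a b) = f a * f b) (p : α → Bool) (S : Set G)
    (hS : ∀ a, f a ∈ S ↔ p a = true) : LocallyMaximalPF S ↔ tpf op p ∧ tlm op p := by
  rw [locallyMaximalPF_iff, tpf_iff op f hf hop p S hS, hf.surjective.forall]
  refine and_congr_right fun _ => forall_congr' fun x => ?_
  rw [hS, tpf_iff op f hf hop (fun y => p y || decide (y = x)) (insert (f x) S)]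
  · simp
  · intro a
    simp [hS, hf.injective.eq_iff, or_comm]

theorem not_filled_of_table {α G : Type*} [Group G] [DecidableEq α] (op : α → α → α) (f : α → G)
    (hf : Function.Bijective f) (hop : ∀ a b, f (op a b) = f a * f b) (p : α → Bool)
    (h1 : tpf op p) (h2 : tlm op p) (g : α) (hg : f g ≠ 1) (hpg : p g = false)
    (hgg : ∀ a, p a = true → ∀ b, p b = true → op a b ≠ g) : ¬ Filled G := by
  intro hF
  have hS : ∀ a, f a ∈ f '' {a | p a = true} ↔ p a = true := by
    intro a
    rw [hf.injective.mem_set_image]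
    rfl
  rcases hF (f '' {a | p a = true}) ((tlm_iff op f hf hop p _ hS).2 ⟨h1, h2⟩) (f g) hg with h | h
  · rw [hS] at h
    simp [h] at hpg
  · obtain ⟨_, ⟨a, ha, rfl⟩, _, ⟨b, hb, rfl⟩, hab⟩ := h
    refine hgg a ha b hb (hf.injective ?_)
    rw [hop]
    exact hab

def op16 (r s : ZMod 8) (x y : ZMod 8 × Bool) : ZMod 8 × Bool :=
  (x.1 + (bif x.2 then r * y.1 else y.1) + (bif x.2 && y.2 then s else 0), xor x.2 y.2)

def S16 : ZMod 8 × Bool → Bool := fun x =>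
  decide (x = (0, true) ∨ x = (1, false) ∨ x = (4, true) ∨ x = (6, false))

def T16 : ZMod 8 × Bool → Bool := fun x =>
  decide (x = (1, false) ∨ x = (4, false) ∨ x = (7, false))

set_option maxRecDepth 100000 in
set_option maxHeartbeats 2000000 in
theorem dec_a : tpf (op16 7 0) S16 ∧ tlm (op16 7 0) S16 ∧ S16 (3, false) = false ∧
    ∀ a, S16 a = true → ∀ b, S16 b = true → op16 7 0 a b ≠ (3, false) := by decide +kernel

set_option maxRecDepth 100000 in
set_option maxHeartbeats 2000000 in
theorem dec_b : tpf (op16 3 0) S16 ∧ tlm (op16 3 0) S16 ∧ S16 (3, false) = false ∧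
    ∀ a, S16 a = true → ∀ b, S16 b = true → op16 3 0 a b ≠ (3, false) := by decide +kernel

theorem dec_c : tpf (op16 3 4) S16 ∧ tlm (op16 3 4) S16 ∧ S16 (3, false) = false ∧
    ∀ a, S16 a = true → ∀ b, S16 b = true → op16 3 4 a b ≠ (3, false) := by decide +kernel

theorem dec_d : tpf (op16 7 4) T16 ∧ tlm (op16 7 4) T16 ∧ T16 (0, true) = false ∧
    ∀ a, T16 a = true → ∀ b, T16 b = true → op16 7 4 a b ≠ (0, true) := by decide +kernel

def op8 (x y : ZMod 4 × Bool) : ZMod 4 × Bool :=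
  (x.1 + (bif x.2 then - y.1 else y.1), xor x.2 y.2)

def mk8 (p0 p1 p2 p3 q0 q1 q2 q3 : Bool) (x : ZMod 4 × Bool) : Bool :=
  match x.2, x.1 with
  | false, 0 => p0
  | false, 1 => p1
  | false, 2 => p2
  | false, 3 => p3
  | true, 0 => q0
  | true, 1 => q1
  | true, 2 => q2
  | true, 3 => q3

theorem dec8 : ∀ p0 p1 p2 p3 q0 q1 q2 q3 : Bool,
    tpf op8 (mk8 p0 p1 p2 p3 q0 q1 q2 q3) → tlm op8 (mk8 p0 p1 p2 p3 q0 q1 q2 q3) →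
    ∀ g, g ≠ (0, false) → mk8 p0 p1 p2 p3 q0 q1 q2 q3 g = true ∨
      ∃ a, mk8 p0 p1 p2 p3 q0 q1 q2 q3 a = true ∧ ∃ b, mk8 p0 p1 p2 p3 q0 q1 q2 q3 b = true ∧
        op8 a b = g := by decide +kernel

def f8 (x : ZMod 4 × Bool) : DihedralGroup 4 :=
  DihedralGroup.r x.1 * (bif x.2 then DihedralGroup.sr 0 else 1)

theorem f8_bij : Function.Bijective f8 := by
  unfold Function.Bijective Function.Injective Function.Surjective
  decide +kernel

theorem f8_op : ∀ a b, f8 (op8 a b) = f8 a * f8 b := by decide +kernel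

theorem filled_D4 : Filled (DihedralGroup 4) := by
  classical
  intro S hS g hg
  obtain ⟨x, rfl⟩ := f8_bij.surjective g
  let p : ZMod 4 × Bool → Bool := fun a => decide (f8 a ∈ S)
  have hp : ∀ a, f8 a ∈ S ↔ p a = true := by intro a; simp [p]
  have hpe : p = mk8 (p (0, false)) (p (1, false)) (p (2, false)) (p (3, false))
      (p (0, true)) (p (1, true)) (p (2, true)) (p (3, true)) := by
    funext ⟨i, j⟩
    cases j <;> fin_cases i <;> rfl
  have h := (tlm_iff op8 f8 f8_bij f8_op p S hp).1 hS
  have hx : x ≠ (0, false) := by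
    rintro rfl
    exact hg rfl
  have key := dec8 (p (0, false)) (p (1, false)) (p (2, false)) (p (3, false))
      (p (0, true)) (p (1, true)) (p (2, true)) (p (3, true))
  rw [← hpe] at key
  rcases key h.1 h.2 x hx with h | ⟨a, ha, b, hb, hab⟩
  · exact Or.inl ((hp x).2 h)
  · refine Or.inr ⟨f8 a, (hp a).2 ha, f8 b, (hp b).2 hb, ?_⟩
    rw [← hab, f8_op]

open Subgroup in
theorem card_quot_center {G : Type*} [Group G] [Finite G] (k : ℕ) (hk : 0 < k)
    (hcard : Nat.card G = 2 ^ k) :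
    ∃ j i, 0 < i ∧ j + i = k ∧ Nat.card (G ⧸ center G) = 2 ^ j ∧ Nat.card (center G) = 2 ^ i := by
  have : Fact (Nat.Prime 2) := ⟨Nat.prime_two⟩
  obtain ⟨i, hi, hZ⟩ := IsPGroup.card_center_eq_prime_pow hcard hk
  have hmul := card_eq_card_quotient_mul_card_subgroup (center G)
  have hdvd : Nat.card (G ⧸ center G) ∣ 2 ^ k := hcard ▸ Dvd.intro _ hmul.symm
  obtain ⟨j, -, hj⟩ := (Nat.dvd_prime_pow Nat.prime_two).1 hdvd
  refine ⟨j, i, hi, ?_, hj, hZ⟩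
  rw [hcard, hj, hZ, ← pow_add] at hmul
  exact (Nat.pow_right_injective le_rfl hmul).symm

open Subgroup in
theorem class_bound (k : ℕ) : ∀ (G : Type*) [Group G] [Finite G] [Group.IsNilpotent G],
    Nat.card G = 2 ^ k → Group.nilpotencyClass G ≤ max 1 (k - 1) := by
  have : Fact (Nat.Prime 2) := ⟨Nat.prime_two⟩
  induction k using Nat.strong_induction_on with
  | _ k ih =>
    intro G _ _ _ hcard
    by_cases hk : k ≤ 2
    · refine le_trans ?_ (le_max_left _ _)
      rw [Group.IsNilpotent.nilpotencyClass_le_one_iff]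
      interval_cases k
      · have : IsCyclic G := isCyclic_of_card_dvd_prime (p := 2) (by simp [hcard])
        infer_instance
      · have : IsCyclic G := isCyclic_of_card_dvd_prime (p := 2) (by simp [hcard])
        infer_instance
      · exact IsPGroup.isMulCommutative_of_card_eq_prime_sq hcard
    · obtain ⟨j, i, hi, hji, hj, hZ⟩ := card_quot_center k (by omega) hcard
      have h1 := ih j (by omega) (G ⧸ center G) hj
      rw [Group.nilpotencyClass_quotient_center] at h1
      omega

open Subgroup in
theorem max_class_structure {G : Type*} [Group G] [Finite G] [Group.IsNilpotent G] (m : ℕ)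
    (hm : 2 < m) (hcard : Nat.card G = 2 ^ m) (hclass : Group.nilpotencyClass G = m - 1) :
    Nat.card (center G) = 2 ∧ Nat.card (G ⧸ center G) = 2 ^ (m - 1) ∧
      Group.nilpotencyClass (G ⧸ center G) = m - 1 - 1 ∧ ¬ IsMulCommutative G ∧
      ¬ IsCyclic (G ⧸ center G) := by
  have : Fact (Nat.Prime 2) := ⟨Nat.prime_two⟩
  have hnc : ¬ IsMulCommutative G := by
    rw [← Group.IsNilpotent.nilpotencyClass_le_one_iff]
    omega
  have hncyc : ¬ IsCyclic (G ⧸ center G) := by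
    intro h
    exact hnc (isMulCommutative_of_isCyclic_quotient_center_self G)
  obtain ⟨j, i, hi, hji, hj, hZ⟩ := card_quot_center m (by omega) hcard
  have hcl : Group.nilpotencyClass (G ⧸ center G) = m - 1 - 1 := by
    rw [Group.nilpotencyClass_quotient_center, hclass]
  have hb := class_bound j (G ⧸ center G) hj
  have hj1 : 1 < j := by
    by_contra hlt
    apply hncyc
    apply isCyclic_of_card_dvd_prime (p := 2)
    rw [hj]
    have : j = 0 ∨ j = 1 := by omega
    rcases this with rfl | rfl <;> simp
  have hj2 : j = m - 1 := by omega
  have hi1 : i = 1 := by omega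
  subst hj2 hi1
  exact ⟨by simpa using hZ, hj, hcl, hnc, hncyc⟩

open Subgroup in
theorem center_elems {G : Type*} [Group G] [Finite G] (h : Nat.card (center G) = 2) :
    ∃ z : G, z ≠ 1 ∧ ∀ x, x ∈ center G ↔ x = 1 ∨ x = z := by
  obtain ⟨⟨z, hz⟩, hz1, -⟩ := (Nat.card_eq_two_iff' (1 : center G)).1 h
  have hu := (Nat.card_eq_two_iff' (1 : center G)).1 h
  refine ⟨z, fun h => hz1 (Subtype.ext h), fun x => ⟨fun hx => ?_, ?_⟩⟩
  · by_cases hx1 : x = 1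
    · exact Or.inl hx1
    · right
      have := hu.unique (y₁ := ⟨x, hx⟩) (y₂ := ⟨z, hz⟩) (fun h => hx1 (congrArg Subtype.val h)) hz1
      exact congrArg Subtype.val this
  · rintro (rfl | rfl)
    · exact one_mem _
    · exact hz

/-- The bijective multiplicative map attached to two generators. -/
theorem table_map {G : Type*} [Group G] [Finite G] (n : ℕ) [NeZero n] (a b : G)
    (ha : a ^ n = 1)
    (hinj : ∀ k : ℕ, k < n → a ^ k = 1 → k = 0) (hb : ∀ k : ℕ, a ^ k ≠ b)
    (hcard : Nat.card G = 2 * n) :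
    Function.Bijective
      (fun x : ZMod n × Bool => a ^ x.1.val * (bif x.2 then b else 1)) := by
  have hord : orderOf a = n := by
    apply le_antisymm (orderOf_le_of_pow_eq_one (NeZero.pos n) ha)
    by_contra hlt
    have := hinj _ (not_le.1 hlt) (pow_orderOf_eq_one a)
    exact (orderOf_pos a).ne' this
  have hpow : ∀ i j : ZMod n, a ^ i.val = a ^ j.val → i = j := by
    intro i j h
    apply ZMod.val_injective n
    exact pow_injOn_Iio_orderOf (by simpa [hord] using ZMod.val_lt i)
      (by simpa [hord] using ZMod.val_lt j) h
  have hne : ∀ i j : ZMod n, a ^ i.val ≠ a ^ j.val * b := by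
    intro i j h
    have h2 : b = (a ^ j.val)⁻¹ * a ^ i.val := by rw [h]; group
    have h3 : (a ^ j.val)⁻¹ = a ^ (n - j.val) := by
      rw [inv_eq_iff_mul_eq_one, ← pow_add, Nat.add_sub_cancel' (ZMod.val_lt j).le, ha]
    rw [h3, ← pow_add] at h2
    exact hb _ h2.symm
  rw [Nat.bijective_iff_injective_and_card]
  constructor
  · rintro ⟨i, _ | _⟩ ⟨j, _ | _⟩ h
    · simp only [cond_false, mul_one] at h
      rw [hpow i j h]
    · simp only [cond_false, cond_true, mul_one] at h
      exact absurd h (hne i j)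
    · simp only [cond_false, cond_true, mul_one] at h
      exact absurd h.symm (hne j i)
    · simp only [cond_true] at h
      rw [hpow i j (mul_right_cancel h)]
  · rw [hcard]
    simp [mul_comm]

theorem table_mul {G : Type*} [Group G] (n : ℕ) [NeZero n] (a b : G)
    (ha : a ^ n = 1) (r s : ℕ) (hr : b * a = a ^ r * b) (hs : b * b = a ^ s)
    (x y : ZMod n × Bool) :
    (fun x : ZMod n × Bool => a ^ x.1.val * (bif x.2 then b else 1))
      (x.1 + (bif x.2 then (r : ZMod n) * y.1 else y.1) +
        (bif x.2 && y.2 then (s : ZMod n) else 0), xor x.2 y.2) =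
    (fun x : ZMod n × Bool => a ^ x.1.val * (bif x.2 then b else 1)) x *
    (fun x : ZMod n × Bool => a ^ x.1.val * (bif x.2 then b else 1)) y := by
  have hmod : ∀ k : ℕ, a ^ ((k : ZMod n).val) = a ^ k := by
    intro k
    rw [ZMod.val_natCast]
    conv_rhs => rw [← Nat.mod_add_div k n, pow_add, pow_mul, ha, one_pow, mul_one]
  have hba : ∀ k : ℕ, b * a ^ k = a ^ (r * k) * b := by
    intro k
    induction k with
    | zero => simp
    | succ k ih => rw [pow_succ, ← mul_assoc, ih, mul_assoc, hr, ← mul_assoc, ← pow_add]; rfl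
  obtain ⟨i, e⟩ := x
  obtain ⟨j, f⟩ := y
  obtain ⟨i, rfl⟩ := ZMod.natCast_zmod_surjective i
  obtain ⟨j, rfl⟩ := ZMod.natCast_zmod_surjective j
  cases e <;> cases f
  · simp only [cond_false, Bool.and_false, Bool.xor_false, mul_one, add_zero]
    rw [← Nat.cast_add, hmod, hmod, hmod, pow_add]
  · simp only [cond_false, cond_true, Bool.and_true, Bool.xor_true, Bool.not_false, mul_one,
      add_zero]
    rw [← Nat.cast_add, hmod, hmod, hmod, pow_add, mul_assoc]
  · simp only [cond_false, cond_true, Bool.and_false, Bool.xor_false, mul_one, add_zero]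
    rw [← Nat.cast_mul, ← Nat.cast_add, hmod, hmod, hmod, pow_add, mul_assoc, mul_assoc, hba]
  · simp only [cond_false, cond_true, Bool.and_true, Bool.xor_true, Bool.not_true, mul_one]
    rw [← Nat.cast_mul, ← Nat.cast_add, ← Nat.cast_add, hmod, hmod, hmod, pow_add, pow_add, ← hs]
    calc a ^ i * a ^ (r * j) * (b * b) = a ^ i * (a ^ (r * j) * b) * b := by group
      _ = _ := by rw [← hba]; group

open Subgroup in
theorem order_sixteen {G : Type*} [Group G] [Finite G] (hcard : Nat.card G = 16)
    (hZ : Nat.card (center G) = 2) (e : (G ⧸ center G) ≃* DihedralGroup 4) : ¬ Filled G := by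
  obtain ⟨z, hz1, hz⟩ := center_elems hZ
  let f : G →* DihedralGroup 4 := e.toMonoidHom.comp (QuotientGroup.mk' (center G))
  have hfs : Function.Surjective f :=
    e.surjective.comp (QuotientGroup.mk'_surjective (center G))
  have hker : ∀ x, f x = 1 ↔ x = 1 ∨ x = z := by
    intro x
    rw [← hz]
    simp [f]
  obtain ⟨a, ha⟩ := hfs (DihedralGroup.r 1)
  obtain ⟨b, hb⟩ := hfs (DihedralGroup.sr 0)
  have hzc : ∀ g, g * z = z * g := fun g => (mem_center_iff.1 ((hz z).2 (Or.inr rfl)) g)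
  have hzz : z * z = 1 := by
    rcases (hz (z * z)).1 (mul_mem ((hz z).2 (Or.inr rfl)) ((hz z).2 (Or.inr rfl))) with h | h
    · exact h
    · exact absurd (by simpa using h) hz1
  have hconj : b * a * b⁻¹ * a = 1 ∨ b * a * b⁻¹ * a = z := by
    rw [← hker]
    simp only [map_mul, map_inv, ha, hb]
    decide
  have ha2 : ¬ (a ^ 2 ∈ center G) := by
    rw [hz, ← hker, map_pow, ha]
    decide
  have hgen : ∀ g : G, ∃ k : ℕ, ∃ ε : Bool, ∃ w ∈ center G, g = a ^ k * (bif ε then b else 1) * w := by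
    intro g
    have : ∀ d : DihedralGroup 4, ∃ k : Fin 4, ∃ ε : Bool,
        d = DihedralGroup.r 1 ^ (k : ℕ) * (bif ε then DihedralGroup.sr 0 else 1) := by decide
    obtain ⟨k, ε, h⟩ := this (f g)
    refine ⟨k, ε, (a ^ (k : ℕ) * (bif ε then b else 1))⁻¹ * g, ?_, by group⟩
    rw [hz, ← hker, map_mul, map_inv, map_mul, map_pow, ha, h]
    cases ε <;> simp [hb]
  have ha4 : a ^ 4 = z := by
    have : a ^ 4 = 1 ∨ a ^ 4 = z := by
      rw [← hker, map_pow, ha]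
      decide
    rcases this with h | h
    swap
    · exact h
    exfalso
    apply ha2
    have hb2 : b * a ^ 2 = a ^ 2 * b := by
      have hw : ∃ w, w * w = 1 ∧ (∀ g, g * w = w * g) ∧ b * a = w * a⁻¹ * b := by
        rcases hconj with h | h
        · refine ⟨1, by simp, by simp, ?_⟩
          rw [one_mul, ← eq_inv_of_mul_eq_one_left h]; group
        · refine ⟨z, hzz, hzc, ?_⟩
          rw [← h]; group
      obtain ⟨w, hw1, hw2, hw3⟩ := hw
      calc b * a ^ 2 = (b * a) * a := by rw [pow_two, mul_assoc]
        _ = w * a⁻¹ * (b * a) := by rw [hw3]; group; rw [mul_assoc, mul_assoc, hw3]; group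
        _ = w * (a⁻¹ * w) * a⁻¹ * b := by rw [hw3]; group
        _ = w * w * a⁻¹ * a⁻¹ * b := by rw [hw2]; group
        _ = a ^ 2 * b := by
          rw [hw1]
          have : a⁻¹ * a⁻¹ = a ^ 2 := by
            rw [← mul_inv_rev, inv_eq_iff_mul_eq_one, ← h]; group
          rw [one_mul, this]
    rw [mem_center_iff]
    intro g
    obtain ⟨k, ε, w, hw, rfl⟩ := hgen g
    have hw' := mem_center_iff.1 hw
    have c1 : Commute (a ^ 2) (a ^ k) := (Commute.refl a).pow_pow 2 k
    have c2 : Commute (a ^ 2) (bif ε then b else 1) := by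
      cases ε
      · exact Commute.one_right _
      · exact hb2.symm
    have c3 : Commute (a ^ 2) w := hw' _
    exact ((c1.mul_right c2).mul_right c3).symm
  have ha8 : a ^ 8 = 1 := by
    rw [show 8 = 4 + 4 from rfl, pow_add, ha4, hzz]
  have hinj : ∀ k : ℕ, k < 8 → a ^ k = 1 → k = 0 := by
    intro k hk h
    have h4 : f (a ^ k) = 1 := by rw [h, map_one]
    rw [map_pow, ha] at h4
    interval_cases k <;> first | rfl | (exact absurd h4 (by decide)) | skip
    exact absurd (ha4.symm.trans h) hz1
  have hba : ∀ k : ℕ, a ^ k ≠ b := by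
    intro k h
    have := congrArg f h
    rw [map_pow, ha, hb, DihedralGroup.r_one_pow] at this
    cases this
  have hbij := table_map 8 a b ha8 hinj hba hcard
  have hbb : b * b = a ^ 0 ∨ b * b = a ^ 4 := by
    rw [ha4, pow_zero, ← hker, map_mul, hb]
    decide
  have hconj' : b * a = a ^ 7 * b ∨ b * a = a ^ 3 * b := by
    rcases hconj with h | h
    · left
      have : a ^ 7 = a⁻¹ := by rw [eq_inv_iff_mul_eq_one, ← pow_succ, ha8]
      rw [this, ← eq_inv_of_mul_eq_one_left h]; group
    · right
      rw [← ha4] at h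
      have : a ^ 3 = a ^ 4 * a⁻¹ := by group
      rw [this, ← h]; group
  have h3 : a ^ (3 : ZMod 8).val * (bif false then b else 1) ≠ 1 := by
    intro h
    have h' : a ^ 3 = 1 := (mul_one (a ^ 3)).symm.trans h
    exact absurd (hinj 3 (by norm_num) h') (by norm_num)
  have hb1 : a ^ (0 : ZMod 8).val * (bif true then b else 1) ≠ 1 := by
    intro h
    have h' : b = 1 := by simpa using h
    exact hba 0 (by simp [h'])
  rcases hconj' with hr | hr <;> rcases hbb with hs | hs
  · exact not_filled_of_table (op16 7 0) _ hbij
      (fun x y => by simpa [op16] using table_mul 8 a b ha8 7 0 hr hs x y) S16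
      dec_a.1 dec_a.2.1 (3, false) h3 dec_a.2.2.1 dec_a.2.2.2
  · exact not_filled_of_table (op16 7 4) _ hbij (table_mul 8 a b ha8 7 4 hr hs) T16
      dec_d.1 dec_d.2.1 (0, true) hb1 dec_d.2.2.1 dec_d.2.2.2
  · exact not_filled_of_table (op16 3 0) _ hbij
      (fun x y => by simpa [op16] using table_mul 8 a b ha8 3 0 hr hs x y) S16
      dec_b.1 dec_b.2.1 (3, false) h3 dec_b.2.2.1 dec_b.2.2.2
  · exact not_filled_of_table (op16 3 4) _ hbij (table_mul 8 a b ha8 3 4 hr hs) S16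
      dec_c.1 dec_c.2.1 (3, false) h3 dec_c.2.2.1 dec_c.2.2.2

open Subgroup in
theorem order_eight {G : Type*} [Group G] [Finite G] [Group.IsNilpotent G]
    (hcard : Nat.card G = 2 ^ 3) (hclass : Group.nilpotencyClass G = 2) (hF : Filled G) :
    Nonempty (G ≃* DihedralGroup 4) := by
  obtain ⟨hZ, hQ, hQc, hnc, hncyc⟩ := max_class_structure 3 (by norm_num) hcard hclass
  obtain ⟨z, hz1, hz⟩ := center_elems hZ
  have hzz : z * z = 1 := by
    rcases (hz (z * z)).1 (mul_mem ((hz z).2 (Or.inr rfl)) ((hz z).2 (Or.inr rfl))) with h | h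
    · exact h
    · exact absurd (by simpa using h) hz1
  have hsq : ∀ g : G, g * g = 1 ∨ g * g = z := by
    intro g
    rw [← hz, ← QuotientGroup.eq_one_iff, QuotientGroup.mk_mul]
    by_contra h
    apply hncyc
    apply isCyclic_of_orderOf_eq_card (g : G ⧸ center G)
    have hdvd := orderOf_dvd_natCard (g : G ⧸ center G)
    rw [hQ] at hdvd ⊢
    have : Fact (Nat.Prime 2) := ⟨Nat.prime_two⟩
    refine orderOf_eq_prime_pow (n := 1) ?_ ?_
    · rwa [pow_one, pow_two]
    · exact orderOf_dvd_iff_pow_eq_one.1 hdvd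
  have hQcomm : IsMulCommutative (G ⧸ center G) := by
    rw [← Group.IsNilpotent.nilpotencyClass_le_one_iff, hQc]
  have hcomm : ∀ x y : G, x * y * x⁻¹ * y⁻¹ = 1 ∨ x * y * x⁻¹ * y⁻¹ = z := by
    intro x y
    rw [← hz, ← QuotientGroup.eq_one_iff]
    simp only [QuotientGroup.mk_mul, QuotientGroup.mk_inv]
    rw [hQcomm.is_comm.comm (x : G ⧸ center G) y]
    group
  -- a non-central involution
  have hinv : ∃ b : G, b ≠ 1 ∧ b ≠ z ∧ b * b = 1 := by
    by_contra hno
    push Not at hno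
    have hL : LocallyMaximalPF ({z} : Set G) := by
      rw [locallyMaximalPF_iff, productFree_iff]
      constructor
      · simp [hz1]
      · intro x hx hp
        rw [productFree_iff] at hp
        by_cases hx1 : x = 1
        · exact hp x (by simp) x (by simp) (by simp [hx1])
        · have := hno x hx1 hx
          exact hp x (by simp) x (by simp) (by simp [(hsq x).resolve_left this])
    have hx : ∃ x, x ∉ center G := by
      by_contra hall
      push Not at hall
      exact hnc ⟨⟨fun x y => (mem_center_iff.1 (hall y) x)⟩⟩
    obtain ⟨x, hx⟩ := hx
    rw [hz, not_or] at hx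
    rcases hF _ hL x hx.1 with h | h
    · exact hx.2 h
    · rw [Set.singleton_mul_singleton, hzz] at h
      exact hx.1 h
  obtain ⟨b, hb1, hbz, hbb⟩ := hinv
  have hexa : ∃ a : G, a * a = z := by
    by_contra hno
    push Not at hno
    have h1 : ∀ g : G, g * g = 1 := fun g => (hsq g).resolve_right (hno g)
    apply hnc
    refine ⟨⟨fun x y => ?_⟩⟩
    have hi : ∀ g : G, g⁻¹ = g := fun g => inv_eq_of_mul_eq_one_left (h1 g)
    calc x * y = (x * y)⁻¹ := (hi _).symm
      _ = y * x := by rw [mul_inv_rev, hi, hi]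
  obtain ⟨a, haa⟩ := hexa
  have ha4 : a ^ 4 = 1 := by
    rw [show 4 = 2 + 2 from rfl, pow_add, pow_two, haa, hzz]
  have ha1 : a ≠ 1 := by
    rintro rfl
    exact hz1 (by simpa using haa.symm)
  have haz : a ≠ z := by
    rintro rfl
    exact hz1 (haa.symm.trans hzz)
  have ha3 : a ^ 3 = z * a := by rw [pow_succ, pow_two, haa]
  have hinj : ∀ k : ℕ, k < 4 → a ^ k = 1 → k = 0 := by
    intro k hk h
    interval_cases k
    · rfl
    · exact absurd (by simpa using h) ha1
    · exact absurd (by rw [← haa, ← pow_two, h]) hz1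
    · rw [ha3] at h
      exact absurd (by rw [eq_inv_of_mul_eq_one_right h]; exact inv_eq_of_mul_eq_one_left hzz) haz
  have hba : ∀ k : ℕ, a ^ k ≠ b := by
    intro k h
    rw [← Nat.mod_add_div k 4, pow_add, pow_mul, ha4, one_pow, mul_one] at h
    have hk := Nat.mod_lt k (show 0 < 4 by norm_num)
    generalize k % 4 = l at h hk
    have hlz : a ^ (2 * l) = 1 := by rw [two_mul, pow_add, h, hbb]
    interval_cases l
    · exact hb1 (by simpa using h.symm)
    · exact absurd (hinj 2 (by norm_num) hlz) (by norm_num)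
    · exact hbz (by rw [← h, pow_two, haa])
    · rw [show 2 * 3 = 4 + 2 from rfl, pow_add, ha4, one_mul] at hlz
      exact absurd (hinj 2 (by norm_num) hlz) (by norm_num)
  have hbij := table_map 4 a b ha4 hinj hba hcard
  have hr : b * a = a ^ 3 * b := by
    rcases hcomm b a with h | h
    · exfalso
      have hab : Commute a b := by
        have : b * a = a * b := by
          have h2 : b * a * b⁻¹ = a := mul_inv_eq_one.1 h
          exact mul_inv_eq_iff_eq_mul.1 h2
        exact this.symm
      have hac : a ∈ center G := by
        rw [mem_center_iff]
        intro g
        obtain ⟨⟨i, ε⟩, rfl⟩ := hbij.surjective g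
        have c1 : Commute a (a ^ i.val) := (Commute.refl a).pow_right _
        have c2 : Commute a (bif ε then b else 1) := by
          cases ε
          · exact Commute.one_right _
          · exact hab
        exact (c1.mul_right c2).symm
      rcases (hz a).1 hac with h | h
      · exact ha1 h
      · exact haz h
    · rw [ha3, ← h]
      group
  have hmul := table_mul 4 a b ha4 3 0 hr (by simpa using hbb)
  have hop : ∀ x y : ZMod 4 × Bool, op8 x y = (x.1 + (bif x.2 then ((3 : ℕ) : ZMod 4) * y.1 else y.1) +
        (bif x.2 && y.2 then ((0 : ℕ) : ZMod 4) else 0), xor x.2 y.2) := by decide +kernel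
  let E : (ZMod 4 × Bool) ≃ G := Equiv.ofBijective _ hbij
  let F : (ZMod 4 × Bool) ≃ DihedralGroup 4 := Equiv.ofBijective _ f8_bij
  have hE : ∀ x y, E (op8 x y) = E x * E y := by
    intro x y
    rw [hop]
    exact hmul x y
  have hF8 : ∀ x y, F (op8 x y) = F x * F y := f8_op
  refine ⟨⟨E.symm.trans F, fun x y => ?_⟩⟩
  obtain ⟨x, rfl⟩ := E.surjective x
  obtain ⟨y, rfl⟩ := E.surjective y
  simp [← hE, hF8]

open Subgroup in
theorem big_not_filled (k : ℕ) : ∀ (G : Type*) [Group G] [Finite G] [Group.IsNilpotent G],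
    Nat.card G = 2 ^ (k + 4) → Group.nilpotencyClass G = k + 3 → ¬ Filled G := by
  induction k with
  | zero =>
    intro G _ _ _ hcard hclass hF
    obtain ⟨hZ, hQ, hQc, -, -⟩ := max_class_structure 4 (by norm_num) hcard hclass
    have hFQ := filled_of_surjective _ (QuotientGroup.mk'_surjective (center G)) hF
    obtain ⟨e⟩ := order_eight hQ hQc hFQ
    exact order_sixteen hcard hZ e hF
  | succ k ih =>
    intro G _ _ _ hcard hclass hF
    obtain ⟨hZ, hQ, hQc, -, -⟩ := max_class_structure (k + 1 + 4) (by omega) hcard hclass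
    exact ih (G ⧸ center G) hQ hQc
      (filled_of_surjective _ (QuotientGroup.mk'_surjective (center G)) hF)

theorem maximal_class_two_group_filled_iff
    {G : Type*} [Group G] [Finite G] [Group.IsNilpotent G] (m : ℕ) (hm : 2 < m)
    (hcard : Nat.card G = 2 ^ m) (hclass : Group.nilpotencyClass G = m - 1) :
    Filled G ↔ Nonempty (G ≃* DihedralGroup 4) := by
  constructor
  · intro hF
    obtain rfl | hm4 : m = 3 ∨ 4 ≤ m := by omega
    · exact order_eight hcard hclass hF
    · obtain ⟨k, rfl⟩ := Nat.exists_eq_add_of_le' hm4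
      exact absurd hF (big_not_filled k G hcard hclass)
  · rintro ⟨e⟩
    exact filled_of_surjective e.symm.toMonoidHom e.symm.surjective filled_D4
end
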